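/- Define T' : [−M, 0]^{m×n} → ℝ^{m×n} coordinatewise by T'_{kj}(y) = min{ y_{kj} − h(y_k), −A_{kj}(y)·1_{{h(y_k)=0}} }, where 1_{{h(y_k)=0}} equals 1 if h(y_k) = 0 and 0 otherwise, and M = 2V + 1 with V = Σ_{ℓ,i} v_{ℓi}. Then an EFX allocation exists if and only if T' has a fixed point in [−M, 0]^{m×n}. -/

import Mathlib

/-- Max of a row: `h(z) = max_r z_r` (realized as `sSup` of the finite range). -/
noncomputable def rowMax {n : ℕ} (z : Fin n → ℝ) : ℝ := sSup (Set.range z)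

/-- The continuous-extension upper bound `g(x,λ)` from the paper. -/
noncomputable def gfun {m n : ℕ} (v x : Fin m → Fin n → ℝ) (lam : ℝ) : ℝ :=
  (1 / lam) * Real.log
    (∑ p ∈ Finset.univ.filter (fun p : Fin n × Fin n => p.1 ≠ p.2),
      ∑ k : Fin m, x k p.2 *
        ∏ ℓ ∈ Finset.univ.erase k,
          (1 - x ℓ p.1 - x ℓ p.2 + x ℓ p.1 * Real.exp (-lam * v ℓ p.1)
            + x ℓ p.2 * Real.exp (lam * v ℓ p.1)))

/-- `X` is an EFX allocation: a partition of the goods such that for all agents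
`i, j` and every good `k ∈ X_j`, `Σ_{ℓ∈X_i} v_{ℓi} ≥ Σ_{ℓ∈X_j} v_{ℓi} − v_{ki}`. -/
def IsEFX {m n : ℕ} (v : Fin m → Fin n → ℝ) (X : Fin n → Finset (Fin m)) : Prop :=
  (∀ i j, i ≠ j → Disjoint (X i) (X j)) ∧
  (Finset.univ.biUnion X = (Finset.univ : Finset (Fin m))) ∧
  (∀ i j : Fin n, ∀ k ∈ X j, (∑ ℓ ∈ X i, v ℓ i) ≥ (∑ ℓ ∈ X j, v ℓ i) - v k i)

/-- `A_{kj}(y) = max_{i≠j} Σ_{ℓ≠k} ( h(y_ℓ + v_{ℓi}(e_j − e_i)) − h(y_ℓ) )`. -/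
noncomputable def Amap {m n : ℕ} (v y : Fin m → Fin n → ℝ) (k : Fin m) (j : Fin n) : ℝ :=
  sSup { z : ℝ | ∃ i : Fin n, i ≠ j ∧
    z = ∑ ℓ ∈ Finset.univ.erase k,
      (rowMax (fun r => y ℓ r +
          v ℓ i * ((if r = j then (1 : ℝ) else 0) - (if r = i then (1 : ℝ) else 0)))
        - rowMax (y ℓ)) }

/-- The objective `f(y)` of Theorem `thm:f-y`; note that
`max{ y_{ℓi} − v_{ℓi}, y_{ℓj} + v_{ℓi}, max_{r∉{i,j}} y_{ℓr} }` is exactly the max of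
the row `y_ℓ + v_{ℓi}(e_j − e_i)` (and when `n = 2` the innermost max is absent). -/
noncomputable def fobj {m n : ℕ} (v y : Fin m → Fin n → ℝ) : ℝ :=
  sSup { z : ℝ | ∃ i j : Fin n, i ≠ j ∧ ∃ k : Fin m,
      z = y k j + ∑ ℓ ∈ Finset.univ.erase k,
        rowMax (fun r => y ℓ r +
          v ℓ i * ((if r = j then (1 : ℝ) else 0) - (if r = i then (1 : ℝ) else 0))) }
    - ∑ ℓ, rowMax (y ℓ)

theorem le_rowMax {n : ℕ} (z : Fin n → ℝ) (r : Fin n) : z r ≤ rowMax z :=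
  le_csSup (Set.finite_range z).bddAbove ⟨r, rfl⟩

theorem rowMax_le {n : ℕ} (hn : 0 < n) {z : Fin n → ℝ} {c : ℝ} (h : ∀ r, z r ≤ c) :
    rowMax z ≤ c :=
  csSup_le ⟨z ⟨0, hn⟩, ⟨0, hn⟩, rfl⟩ (by rintro _ ⟨r, rfl⟩; exact h r)

theorem exists_eq_rowMax {n : ℕ} (hn : 0 < n) (z : Fin n → ℝ) : ∃ r, z r = rowMax z :=
  Set.Nonempty.csSup_mem (s := Set.range z) ⟨z ⟨0, hn⟩, ⟨0, hn⟩, rfl⟩ (Set.finite_range z)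

/-- The row `z + a (e_j − e_i)`. -/
def transfer {n : ℕ} (z : Fin n → ℝ) (a : ℝ) (i j : Fin n) : Fin n → ℝ :=
  fun r => z r + a * ((if r = j then (1 : ℝ) else 0) - (if r = i then (1 : ℝ) else 0))

theorem transfer_apply_right {n : ℕ} (z : Fin n → ℝ) (a : ℝ) {i j : Fin n} (h : i ≠ j) :
    transfer z a i j j = z j + a := by
  simp [transfer, h.symm]

theorem transfer_apply_left {n : ℕ} (z : Fin n → ℝ) (a : ℝ) {i j : Fin n} (h : i ≠ j) :
    transfer z a i j i = z i - a := by
  simp [transfer, h, sub_eq_add_neg]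

theorem transfer_apply_of_ne {n : ℕ} (z : Fin n → ℝ) (a : ℝ) {i j r : Fin n}
    (hi : r ≠ i) (hj : r ≠ j) : transfer z a i j r = z r := by
  simp [transfer, hi, hj]

theorem transfer_le_add {n : ℕ} (z : Fin n → ℝ) {a : ℝ} (ha : 0 ≤ a) (i j r : Fin n) :
    transfer z a i j r ≤ z r + a := by
  unfold transfer
  split_ifs <;> linarith

theorem Amap_le_iff {m n : ℕ} (hn : 2 ≤ n) (v y : Fin m → Fin n → ℝ) (k : Fin m) (j : Fin n)
    (c : ℝ) :
    Amap v y k j ≤ c ↔ ∀ i, i ≠ j →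
      ∑ ℓ ∈ Finset.univ.erase k, (rowMax (transfer (y ℓ) (v ℓ i) i j) - rowMax (y ℓ)) ≤ c := by
  have : Nontrivial (Fin n) := Fin.nontrivial_iff_two_le.2 hn
  obtain ⟨i₀, hi₀⟩ := exists_ne j
  constructor
  · intro h i hi
    refine le_trans (le_csSup ?_ ?_) h
    on_goal 2 => exact ⟨i, hi, rfl⟩
    refine ((Set.finite_range fun i => ∑ ℓ ∈ Finset.univ.erase k,
      (rowMax (transfer (y ℓ) (v ℓ i) i j) - rowMax (y ℓ))).subset ?_).bddAbove
    rintro _ ⟨i, -, rfl⟩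
    exact ⟨i, rfl⟩
  · intro h
    refine csSup_le ⟨_, i₀, hi₀, rfl⟩ ?_
    rintro _ ⟨i, hi, rfl⟩
    exact h i hi

theorem sum_erase_ite_sub_ite {m : ℕ} (w : Fin m → ℝ) {S T : Finset (Fin m)}
    (hST : Disjoint S T) {k : Fin m} (hk : k ∈ T) :
    ∑ ℓ ∈ Finset.univ.erase k, ((if ℓ ∈ T then w ℓ else 0) - (if ℓ ∈ S then w ℓ else 0)) =
      ∑ ℓ ∈ T, w ℓ - w k - ∑ ℓ ∈ S, w ℓ := by
  have hkS : k ∉ S := Finset.disjoint_right.1 hST hk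
  rw [Finset.sum_erase_eq_sub (Finset.mem_univ k), Finset.sum_sub_distrib]
  simp only [Finset.sum_ite_mem, Finset.univ_inter, hk, hkS, if_true, if_false]
  ring

theorem fixedPoint_iff {m n : ℕ} (hn : 2 ≤ n) (v : Fin m → Fin n → ℝ) {y : Fin m → Fin n → ℝ}
    (hy : ∀ k j, y k j ≤ 0) :
    (fun (k : Fin m) (j : Fin n) =>
        min (y k j - rowMax (y k))
          (-(Amap v y k j) * (if rowMax (y k) = 0 then (1 : ℝ) else 0))) = y ↔
      (∀ k, rowMax (y k) = 0) ∧ ∀ k j, Amap v y k j ≤ -y k j := by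
  constructor
  · intro h
    have hfix : ∀ k j, min (y k j - rowMax (y k))
        (-(Amap v y k j) * (if rowMax (y k) = 0 then (1 : ℝ) else 0)) = y k j :=
      fun k j => congrFun (congrFun h k) j
    have h0 : ∀ k, rowMax (y k) = 0 := by
      intro k
      by_contra hne
      have hlt : rowMax (y k) < 0 := lt_of_le_of_ne (rowMax_le (by omega) (hy k)) hne
      obtain ⟨j, hj⟩ := exists_eq_rowMax (by omega) (y k)
      have hkj := hfix k j
      rw [if_neg hne, hj, sub_self, mul_zero, min_self] at hkj
      exact hne hkj.symm
    refine ⟨h0, fun k j => ?_⟩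
    have hkj := hfix k j
    rw [if_pos (h0 k), h0 k, sub_zero, mul_one, min_eq_left_iff] at hkj
    linarith
  · rintro ⟨h0, hA⟩
    funext k j
    have := hA k j
    rw [if_pos (h0 k), h0 k, sub_zero, mul_one, min_eq_left_iff]
    linarith

theorem exists_isEFX_of_Amap_le {m n : ℕ} (hn : 2 ≤ n) {v : Fin m → Fin n → ℝ}
    (hv : ∀ k i, 0 ≤ v k i) {y : Fin m → Fin n → ℝ} (h0 : ∀ k, rowMax (y k) = 0)
    (hA : ∀ k j, Amap v y k j ≤ -y k j) : ∃ X : Fin n → Finset (Fin m), IsEFX v X := by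
  choose g hg using fun k => exists_eq_rowMax (by omega) (y k)
  replace hg : ∀ k, y k (g k) = 0 := fun k => (hg k).trans (h0 k)
  have hdisj : ∀ i j, i ≠ j →
      Disjoint (Finset.univ.filter fun k => g k = i) (Finset.univ.filter fun k => g k = j) := by
    intro i j hij
    rw [Finset.disjoint_filter]
    rintro k - rfl
    exact hij
  refine ⟨fun j => Finset.univ.filter fun k => g k = j, hdisj, by ext k; simp, ?_⟩
  intro i j k hk
  by_cases hij : i = j
  · subst hij
    linarith [hv k i]
  have hkj : g k = j := by simpa using hk
  have hAi := (Amap_le_iff hn v y k j _).1 (hA k j) i hij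
  rw [← hkj, hg k, neg_zero, hkj] at hAi
  have hle : ∀ ℓ ∈ Finset.univ.erase k,
      ((if ℓ ∈ Finset.univ.filter (fun k => g k = j) then v ℓ i else 0) -
        (if ℓ ∈ Finset.univ.filter (fun k => g k = i) then v ℓ i else 0)) ≤
      rowMax (transfer (y ℓ) (v ℓ i) i j) - rowMax (y ℓ) := by
    intro ℓ _
    have hmax := le_rowMax (transfer (y ℓ) (v ℓ i) i j) (g ℓ)
    have hgl := hg ℓ
    rw [h0 ℓ]
    simp only [Finset.mem_filter, Finset.mem_univ, true_and]
    by_cases hj : g ℓ = j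
    · rw [hj] at hgl hmax
      rw [transfer_apply_right _ _ hij] at hmax
      rw [if_pos hj, if_neg (fun h => hij (h.symm.trans hj))]
      linarith
    · by_cases hi : g ℓ = i
      · rw [hi] at hgl hmax
        rw [transfer_apply_left _ _ hij] at hmax
        rw [if_neg hj, if_pos hi]
        linarith
      · rw [transfer_apply_of_ne _ _ hi hj] at hmax
        rw [if_neg hj, if_neg hi]
        linarith
  have hsum := Finset.sum_le_sum hle
  rw [sum_erase_ite_sub_ite (fun ℓ => v ℓ i) (hdisj i j hij) hk] at hsum
  linarith

/-- The signed indicator of an allocation: `0` on owned goods and `-C` elsewhere. -/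
def allocationPoint {m n : ℕ} (X : Fin n → Finset (Fin m)) (C : ℝ) : Fin m → Fin n → ℝ :=
  fun k j => if k ∈ X j then 0 else -C

theorem allocationPoint_nonpos {m n : ℕ} (X : Fin n → Finset (Fin m)) {C : ℝ} (hC : 0 ≤ C)
    (k : Fin m) (j : Fin n) : allocationPoint X C k j ≤ 0 := by
  unfold allocationPoint
  split_ifs <;> linarith

theorem rowMax_allocationPoint {m n : ℕ} {v : Fin m → Fin n → ℝ} {X : Fin n → Finset (Fin m)}
    (hX : IsEFX v X) {C : ℝ} (hC : 0 ≤ C) (k : Fin m) : rowMax (allocationPoint X C k) = 0 := by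
  obtain ⟨r, hr⟩ : ∃ r, k ∈ X r := by
    simpa using hX.2.1.symm.subset (Finset.mem_univ k)
  apply le_antisymm
  · exact rowMax_le r.pos fun r => allocationPoint_nonpos X hC k r
  · have := le_rowMax (allocationPoint X C k) r
    rwa [allocationPoint, if_pos hr] at this

theorem rowMax_transfer_allocationPoint_le {m n : ℕ} {X : Fin n → Finset (Fin m)}
    (hX : ∀ i j, i ≠ j → Disjoint (X i) (X j)) {C a : ℝ} (ha : 0 ≤ a) (haC : 2 * a ≤ C)
    {i j : Fin n} (hij : i ≠ j) (ℓ : Fin m) :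
    rowMax (transfer (allocationPoint X C ℓ) a i j) ≤
      (if ℓ ∈ X j then a else 0) - (if ℓ ∈ X i then a else 0) := by
  refine rowMax_le i.pos fun r => ?_
  by_cases hri : r = i
  · subst hri
    rw [transfer_apply_left _ _ hij, allocationPoint]
    split_ifs <;> linarith
  by_cases hrj : r = j
  · subst hrj
    rw [transfer_apply_right _ _ hij, allocationPoint]
    have : ℓ ∈ X i → ℓ ∉ X r := fun h => Finset.disjoint_left.1 (hX i r hij) h
    split_ifs <;> first | linarith | tauto
  · rw [transfer_apply_of_ne _ _ hri hrj, allocationPoint]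
    have : ℓ ∈ X r → ℓ ∉ X i := fun h => Finset.disjoint_left.1 (hX r i hri) h
    split_ifs <;> first | linarith | tauto

theorem Amap_allocationPoint_le {m n : ℕ} (hn : 2 ≤ n) {v : Fin m → Fin n → ℝ}
    (hv : ∀ k i, 0 ≤ v k i) {X : Fin n → Finset (Fin m)} (hX : IsEFX v X) {C : ℝ}
    (hC : 2 * ∑ ℓ, ∑ i, v ℓ i ≤ C) (k : Fin m) (j : Fin n) :
    Amap v (allocationPoint X C) k j ≤ -allocationPoint X C k j := by
  have hV : 0 ≤ ∑ ℓ, ∑ i, v ℓ i :=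
    Finset.sum_nonneg fun ℓ _ => Finset.sum_nonneg fun i _ => hv ℓ i
  have hrow : ∀ ℓ i, v ℓ i ≤ ∑ i, v ℓ i := fun ℓ i =>
    Finset.single_le_sum (fun i _ => hv ℓ i) (Finset.mem_univ i)
  have hvV : ∀ ℓ i, v ℓ i ≤ ∑ ℓ, ∑ i, v ℓ i := fun ℓ i =>
    (hrow ℓ i).trans (Finset.single_le_sum (f := fun ℓ => ∑ i, v ℓ i)
      (fun ℓ _ => Finset.sum_nonneg fun i _ => hv ℓ i) (Finset.mem_univ ℓ))
  rw [Amap_le_iff hn]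
  intro i hij
  simp only [rowMax_allocationPoint hX (show 0 ≤ C by linarith), sub_zero]
  by_cases hk : k ∈ X j
  · have hle := Finset.sum_le_sum fun ℓ (_ : ℓ ∈ Finset.univ.erase k) =>
      rowMax_transfer_allocationPoint_le hX.1 (hv ℓ i) (by linarith [hvV ℓ i] : 2 * v ℓ i ≤ C)
        hij ℓ
    rw [sum_erase_ite_sub_ite (fun ℓ => v ℓ i) (hX.1 i j hij) hk] at hle
    rw [allocationPoint, if_pos hk]
    linarith [hX.2.2 i j k hk]
  · rw [show allocationPoint X C k j = -C from if_neg hk, neg_neg]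
    calc ∑ ℓ ∈ Finset.univ.erase k, rowMax (transfer (allocationPoint X C ℓ) (v ℓ i) i j)
        ≤ ∑ ℓ ∈ Finset.univ.erase k, ∑ i, v ℓ i := by
          refine Finset.sum_le_sum fun ℓ _ => rowMax_le i.pos fun r => ?_
          linarith [transfer_le_add (allocationPoint X C ℓ) (hv ℓ i) i j r, hrow ℓ i,
            allocationPoint_nonpos X (show 0 ≤ C by linarith) ℓ r]
      _ ≤ ∑ ℓ, ∑ i, v ℓ i :=
          Finset.sum_le_sum_of_subset_of_nonneg (Finset.erase_subset _ _)
            fun ℓ _ _ => Finset.sum_nonneg fun i _ => hv ℓ i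
      _ ≤ C := by linarith

/-- Define `T' : [−M, 0]^{m×n} → ℝ^{m×n}` coordinatewise by
`T'_{kj}(y) = min{ y_{kj} − h(y_k), −A_{kj}(y)·1_{{h(y_k)=0}} }`, where `M = 2V + 1`
and `V = Σ_{ℓ,i} v_{ℓi}`. Then an EFX allocation exists if and only if `T'` has a
fixed point in `[−M, 0]^{m×n}`. -/
theorem stmt_16 (m n : ℕ) (hm : 1 ≤ m) (hn : 2 ≤ n)
    (v : Fin m → Fin n → ℝ) (hv : ∀ k i, 0 ≤ v k i) :
    (∃ X : Fin n → Finset (Fin m), IsEFX v X) ↔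
      (∃ y : Fin m → Fin n → ℝ,
        (∀ k j, y k j ∈ Set.Icc (-(2 * (∑ ℓ : Fin m, ∑ i : Fin n, v ℓ i) + 1)) 0) ∧
        (fun (k : Fin m) (j : Fin n) =>
          min (y k j - rowMax (y k))
            (-(Amap v y k j) * (if rowMax (y k) = 0 then (1 : ℝ) else 0))) = y) := by
  constructor
  · rintro ⟨X, hX⟩
    have hV : 0 ≤ ∑ ℓ, ∑ i, v ℓ i :=
      Finset.sum_nonneg fun ℓ _ => Finset.sum_nonneg fun i _ => hv ℓ i
    have hC : 0 ≤ 2 * (∑ ℓ, ∑ i, v ℓ i) + 1 := by linarith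
    have hy := allocationPoint_nonpos X hC
    refine ⟨allocationPoint X (2 * (∑ ℓ, ∑ i, v ℓ i) + 1), fun k j => ⟨?_, hy k j⟩,
      (fixedPoint_iff hn v hy).2 ⟨rowMax_allocationPoint hX hC,
        Amap_allocationPoint_le hn hv hX (by linarith)⟩⟩
    unfold allocationPoint
    split_ifs <;> linarith
  · rintro ⟨y, hy, hfix⟩
    obtain ⟨h0, hA⟩ := (fixedPoint_iff hn v fun k j => (hy k j).2).1 hfix
    exact exists_isEFX_of_Amap_le hn hv h0 hA
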